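/- arXiv:1503.05536 — 4 statements merged into one kernel-verified Lean document; each statement's English description precedes it below -/
import Mathlib

section
/- Let n > 2 be an integer with n ≠ 4, and let k be an integer with gcd(k, n) = 1. Then the degree of tan(2kπ/n) over ℚ (the degree of its minimal polynomial over ℚ) equals: φ(n) if 4 does not divide n; φ(n)/2 if n ≡ 4 (mod 8); and φ(n)/4 if n ≡ 0 (mod 8). Here φ is the Euler totient function. -/
open IntermediateField Polynomial

/-- Adjoining `I` to a number field generated by a real number doubles its degree. -/
theorem finrank_adjoin_ofReal_I {t : ℝ} (ht : IsIntegral ℚ (t : ℂ)) :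
    Module.finrank ℚ ℚ⟮(t : ℂ), Complex.I⟯ = 2 * (minpoly ℚ t).natDegree := by
  have hI : IsIntegral ℚ⟮(t : ℂ)⟯ Complex.I :=
    ⟨X ^ 2 + 1, by monicity!, by simp⟩
  have hreal : ℚ⟮(t : ℂ)⟯ ≤ (Complex.ofRealAm.restrictScalars ℚ).fieldRange := by
    rw [adjoin_simple_le_iff]
    exact ⟨t, rfl⟩
  have hle : (minpoly ℚ⟮(t : ℂ)⟯ Complex.I).natDegree ≤ 2 := by
    have hmonic : (X ^ 2 + 1 : ℚ⟮(t : ℂ)⟯[X]).Monic := by monicity!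
    refine (natDegree_le_of_dvd (minpoly.dvd _ _ (by simp)) hmonic.ne_zero).trans ?_
    compute_degree
  have hge : 2 ≤ (minpoly ℚ⟮(t : ℂ)⟯ Complex.I).natDegree := by
    rw [minpoly.two_le_natDegree_iff hI]
    rintro ⟨x, hx⟩
    obtain ⟨r, hr⟩ := hreal x.2
    have hrI : (r : ℂ) = Complex.I := hr.trans hx
    simpa using congrArg Complex.im hrI
  have hdeg : (minpoly ℚ (t : ℂ)).natDegree = (minpoly ℚ t).natDegree :=
    congrArg natDegree (minpoly.algebraMap_eq Complex.ofReal_injective t)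
  rw [← adjoin_simple_adjoin_simple]
  calc Module.finrank ℚ ℚ⟮(t : ℂ)⟯⟮Complex.I⟯
      = Module.finrank ℚ ℚ⟮(t : ℂ)⟯ * Module.finrank ℚ⟮(t : ℂ)⟯ ℚ⟮(t : ℂ)⟯⟮Complex.I⟯ :=
        (Module.finrank_mul_finrank ..).symm
    _ = 2 * (minpoly ℚ t).natDegree := by
        rw [adjoin.finrank ht, adjoin.finrank hI, hdeg, le_antisymm hle hge, mul_comm]

/-- If `w` is the Cayley transform of `t`, then `t` and `w` generate the same field over `ℚ(I)`. -/
theorem adjoin_I_eq_sup_of_cayley {t w : ℂ}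
    (h : w * (1 - Complex.I * t) = 1 + Complex.I * t) :
    ℚ⟮t, Complex.I⟯ = ℚ⟮w⟯ ⊔ ℚ⟮Complex.I⟯ := by
  have hw : w + 1 ≠ 0 := fun h0 ↦ by
    rw [eq_neg_of_add_eq_zero_left h0] at h
    have : (2 : ℂ) = 0 := by linear_combination -h
    exact two_ne_zero this
  have ht : 1 - Complex.I * t ≠ 0 := fun h0 ↦ by
    have : (2 : ℂ) = 0 := by linear_combination (1 + w) * h0 - h
    exact two_ne_zero this
  have hwt : w = (1 + Complex.I * t) / (1 - Complex.I * t) := by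
    rw [eq_div_iff ht, h]
  have htw : t = Complex.I * (1 - w) / (w + 1) := by
    rw [eq_div_iff hw]
    linear_combination Complex.I * h + (w * t + t) * Complex.I_sq
  apply le_antisymm
  · have hwmem : w ∈ ℚ⟮w⟯ ⊔ ℚ⟮Complex.I⟯ :=
      (le_sup_left : ℚ⟮w⟯ ≤ ℚ⟮w⟯ ⊔ ℚ⟮Complex.I⟯) (mem_adjoin_simple_self ℚ w)
    have hImem : Complex.I ∈ ℚ⟮w⟯ ⊔ ℚ⟮Complex.I⟯ :=
      (le_sup_right : ℚ⟮Complex.I⟯ ≤ ℚ⟮w⟯ ⊔ ℚ⟮Complex.I⟯) (mem_adjoin_simple_self ℚ _)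
    rw [adjoin_le_iff, Set.insert_subset_iff, Set.singleton_subset_iff]
    refine ⟨?_, hImem⟩
    rw [htw]
    exact div_mem (mul_mem hImem (sub_mem (one_mem _) hwmem)) (add_mem hwmem (one_mem _))
  · have htmem : t ∈ ℚ⟮t, Complex.I⟯ := subset_adjoin _ _ (by simp)
    have hImem : Complex.I ∈ ℚ⟮t, Complex.I⟯ := subset_adjoin _ _ (by simp)
    rw [sup_le_iff, adjoin_simple_le_iff, adjoin_simple_le_iff]
    refine ⟨?_, hImem⟩
    rw [hwt]
    exact div_mem (add_mem (one_mem _) (mul_mem hImem htmem))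
      (sub_mem (one_mem _) (mul_mem hImem htmem))

theorem exp_mul_I_sq_mul_one_sub_I_mul_tan {θ : ℝ} (hθ : Real.cos θ ≠ 0) :
    Complex.exp (θ * Complex.I) ^ 2 * (1 - Complex.I * (Real.tan θ : ℝ)) =
      1 + Complex.I * (Real.tan θ : ℝ) := by
  have hc : Complex.cos θ ≠ 0 := by exact_mod_cast hθ
  rw [Complex.exp_mul_I, Complex.ofReal_tan, Complex.tan_eq_sin_div_cos]
  field_simp
  linear_combination (Complex.cos θ + Complex.sin θ * Complex.I) * Complex.sin_sq_add_cos_sq θ -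
    (Complex.cos θ + Complex.sin θ * Complex.I) * Complex.sin θ ^ 2 * Complex.I_sq

/-- The degree of `tan θ` is half that of the field obtained by adjoining `I` to `ℚ(e^{2iθ})`. -/
theorem two_mul_natDegree_minpoly_tan {θ : ℝ} (hθ : Real.cos θ ≠ 0) {m : ℕ} (hm : m ≠ 0)
    (hw : IsPrimitiveRoot (Complex.exp (θ * Complex.I) ^ 2) m) :
    2 * (minpoly ℚ (Real.tan θ)).natDegree = (m.lcm 4).totient := by
  have : NeZero m := ⟨hm⟩
  have : NeZero (m.lcm 4) := ⟨Nat.lcm_ne_zero hm four_ne_zero⟩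
  have hfield := adjoin_I_eq_sup_of_cayley (exp_mul_I_sq_mul_one_sub_I_mul_tan hθ)
  set w := Complex.exp (θ * Complex.I) ^ 2
  have hcyc : IsCyclotomicExtension {m.lcm 4} ℚ ℚ⟮(Real.tan θ : ℂ), Complex.I⟯ :=
    hfield ▸ isCyclotomicExtension_lcm_sup ℚ ℂ m 4 ℚ⟮w⟯ ℚ⟮Complex.I⟯
      (h₁ := (isCyclotomicExtension_singleton_iff_eq_adjoin m ℚ ℂ _ hw).2 rfl)
      (h₂ := (isCyclotomicExtension_singleton_iff_eq_adjoin 4 ℚ ℂ _ Complex.isPrimitiveRoot_I).2 rfl)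
  have := IsCyclotomicExtension.finite_of_singleton (m.lcm 4) ℚ ℚ⟮(Real.tan θ : ℂ), Complex.I⟯
  have htmem : (Real.tan θ : ℂ) ∈ ℚ⟮(Real.tan θ : ℂ), Complex.I⟯ := subset_adjoin _ _ (by simp)
  have ht : IsIntegral ℚ (Real.tan θ : ℂ) :=
    isIntegral_iff.1 (IsIntegral.of_finite ℚ (⟨_, htmem⟩ : ℚ⟮(Real.tan θ : ℂ), Complex.I⟯))
  rw [← finrank_adjoin_ofReal_I ht, IsCyclotomicExtension.Rat.finrank (m.lcm 4)]

/-- `cos θ` vanishes only if `exp (θ * I)` is a fourth root of unity. -/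
theorem cos_ne_zero_of_isPrimitiveRoot_exp {θ : ℝ} {n : ℕ} (hn : ¬ n ∣ 4)
    (hζ : IsPrimitiveRoot (Complex.exp (θ * Complex.I)) n) : Real.cos θ ≠ 0 := fun h ↦ by
  have hc : Complex.cos θ = 0 := by exact_mod_cast h
  have hs : Complex.sin θ ^ 2 = 1 := by simpa [hc] using Complex.sin_sq_add_cos_sq θ
  refine hn (hζ.dvd_of_pow_eq_one 4 ?_)
  rw [Complex.exp_mul_I, hc, zero_add, mul_pow, Complex.I_pow_four, mul_one]
  linear_combination (Complex.sin θ ^ 2 + 1) * hs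

/-- Complexity Theorem, part (iii) (Niven): for an integer `n > 2` with
`n ≠ 4` and an integer `k` with `gcd(k, n) = 1`, the degree of `tan(2kπ/n)`
over `ℚ` is `φ(n)` if `4 ∤ n`, `φ(n)/2` if `n ≡ 4 (mod 8)`, and `φ(n)/4` if
`n ≡ 0 (mod 8)`. -/
theorem tan_two_mul_degree (n : ℕ) (hn : 2 < n) (hn4 : n ≠ 4) (k : ℤ) (hk : Int.gcd k n = 1) :
    (¬ (4 ∣ n) →
      (minpoly ℚ (Real.tan (2 * k * Real.pi / n))).natDegree = n.totient) ∧
    (n % 8 = 4 →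
      (minpoly ℚ (Real.tan (2 * k * Real.pi / n))).natDegree = n.totient / 2) ∧
    (n % 8 = 0 →
      (minpoly ℚ (Real.tan (2 * k * Real.pi / n))).natDegree = n.totient / 4) := by
  set θ : ℝ := 2 * k * Real.pi / n with hθdef
  have hn0 : n ≠ 0 := by lia
  have hζ : IsPrimitiveRoot (Complex.exp (θ * Complex.I)) n := by
    convert Complex.isPrimitiveRoot_exp_of_isCoprime k n hn0 (Int.isCoprime_iff_gcd_eq_one.2 hk)
      using 2
    push_cast [hθdef]
    ring
  have hn_dvd : ¬ n ∣ 4 := fun h ↦ by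
    have := Nat.le_of_dvd four_pos h
    obtain rfl : n = 3 := by lia
    norm_num at h
  have hcos := cos_ne_zero_of_isPrimitiveRoot_exp hn_dvd hζ
  have hodd (ho : Odd n) : (minpoly ℚ (Real.tan θ)).natDegree = n.totient := by
    have hco : Nat.Coprime n 4 := ho.coprime_two_right.pow_right 2
    have h := two_mul_natDegree_minpoly_tan hcos hn0
      (hζ.pow_of_coprime 2 ho.coprime_two_left)
    rw [hco.lcm_eq_mul, Nat.totient_mul hco, show Nat.totient 4 = 2 by decide] at h
    lia
  have heven (m : ℕ) (hm : n = 2 * m) :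
      2 * (minpoly ℚ (Real.tan θ)).natDegree = (m.lcm 4).totient :=
    two_mul_natDegree_minpoly_tan hcos (by lia) (hζ.pow (by lia) hm)
  refine ⟨fun h4 ↦ ?_, fun h8 ↦ ?_, fun h8 ↦ ?_⟩
  · rcases Nat.even_or_odd' n with ⟨m, hm | hm⟩
    · have ho : Odd m := by rw [Nat.odd_iff]; lia
      have hco : Nat.Coprime m 4 := ho.coprime_two_right.pow_right 2
      have h := heven m hm
      rw [hco.lcm_eq_mul, Nat.totient_mul hco, show Nat.totient 4 = 2 by decide] at h
      rw [hm, Nat.totient_two_mul_of_odd ho]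
      lia
    · exact hodd ⟨m, hm⟩
  · obtain ⟨l, hl⟩ : ∃ l, n = 2 * (2 * l) := ⟨n / 4, by lia⟩
    have ho : Nat.Coprime l 2 := (Nat.odd_iff.2 (by lia)).coprime_two_right
    have hlcm : (2 * l).lcm 4 = n := by
      rw [show 4 = 2 * 2 by rfl, Nat.lcm_mul_left, ho.lcm_eq_mul, mul_comm l, hl]
    have h := heven _ hl
    rw [hlcm] at h
    lia
  · obtain ⟨l, hl⟩ : ∃ l, n = 2 * (4 * l) := ⟨n / 8, by lia⟩
    have h := heven _ hl
    rw [Nat.lcm_eq_left (dvd_mul_right 4 l)] at h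
    rw [hl, Nat.totient_two_mul_of_even ⟨2 * l, by ring⟩]
    lia
end

section
/- Let n > 2 be an integer and let k be an integer with gcd(k, n) = 1. Then the degree of tan(kπ/n) over ℚ (the degree of its minimal polynomial over ℚ) equals φ(n) if 4 does not divide n, and equals φ(n)/2 if 4 divides n. Here φ is the Euler totient function. -/
open Polynomial IntermediateField

/-- Adjoining `I` to the subfield of `ℂ` generated by a real number doubles the degree. -/
theorem finrank_adjoin_ofReal_I_s14 (x : ℝ) :
    Module.finrank ℚ (adjoin ℚ {(x : ℂ), Complex.I}) = 2 * Module.finrank ℚ ℚ⟮(x : ℂ)⟯ := by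
  have hreal (z : ℚ⟮(x : ℂ)⟯) : ∃ r : ℝ, (r : ℂ) = z := by
    have hle : ℚ⟮(x : ℂ)⟯ ≤ (IsScalarTower.toAlgHom ℚ ℝ ℂ).fieldRange := by
      rw [adjoin_simple_le_iff]
      exact ⟨x, rfl⟩
    exact hle z.2
  have hdeg : (X ^ 2 + 1 : ℚ⟮(x : ℂ)⟯[X]).natDegree = 2 := by compute_degree!
  have hmonic : (X ^ 2 + 1 : ℚ⟮(x : ℂ)⟯[X]).Monic := by monicity!
  have hirr : Irreducible (X ^ 2 + 1 : ℚ⟮(x : ℂ)⟯[X]) := by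
    refine irreducible_of_degree_le_three_of_not_isRoot (by simp [hdeg]) fun z hz => ?_
    obtain ⟨r, hr⟩ := hreal z
    have hz' : z ^ 2 + 1 = 0 := by simpa using hz
    have hsq : (z : ℂ) ^ 2 + 1 = 0 := by exact_mod_cast congrArg Subtype.val hz'
    rw [← hr] at hsq
    have : r ^ 2 + 1 = 0 := by exact_mod_cast hsq
    nlinarith [sq_nonneg r]
  have hminpoly : (X ^ 2 + 1 : ℚ⟮(x : ℂ)⟯[X]) = minpoly ℚ⟮(x : ℂ)⟯ Complex.I :=
    minpoly.eq_of_irreducible_of_monic hirr (by simp) hmonic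
  have hint : IsIntegral ℚ⟮(x : ℂ)⟯ Complex.I := ⟨X ^ 2 + 1, hmonic, by simp⟩
  have hrank := adjoin.finrank hint
  rw [← hminpoly, hdeg] at hrank
  have htower := Module.finrank_mul_finrank ℚ ℚ⟮(x : ℂ)⟯ (adjoin ℚ⟮(x : ℂ)⟯ {Complex.I})
  have hadjoin := adjoin_adjoin_left ℚ {(x : ℂ)} {Complex.I}
  rw [Set.singleton_union] at hadjoin
  rw [← hadjoin, mul_comm, ← hrank]
  exact htower.symm

/-- A field generated over `ℚ` by two roots of unity has degree the totient of the lcm of their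
orders. -/
theorem IsPrimitiveRoot.finrank_adjoin_pair {L : Type*} [Field L] [CharZero L] {a b : L}
    {m n : ℕ} (ha : IsPrimitiveRoot a m) (hb : IsPrimitiveRoot b n) (hm : m ≠ 0) (hn : n ≠ 0) :
    Module.finrank ℚ (adjoin ℚ {a, b}) = (m.lcm n).totient := by
  have hc := ha.pow_mul_pow_lcm hb hm hn
  have hpos : 0 < m.lcm n := Nat.pos_of_ne_zero (Nat.lcm_ne_zero hm hn)
  have hadjoin : adjoin ℚ {a, b} =
      ℚ⟮a ^ (m / Nat.factorizationLCMLeft m n) * b ^ (n / Nat.factorizationLCMRight m n)⟯ := by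
    have : NeZero (m.lcm n) := ⟨hpos.ne'⟩
    apply le_antisymm
    · obtain ⟨i, -, hi⟩ := hc.eq_pow_of_pow_eq_one
        ((ha.pow_eq_one_iff_dvd _).mpr (Nat.dvd_lcm_left m n))
      obtain ⟨j, -, hj⟩ := hc.eq_pow_of_pow_eq_one
        ((hb.pow_eq_one_iff_dvd _).mpr (Nat.dvd_lcm_right m n))
      rw [adjoin_le_iff, Set.insert_subset_iff, Set.singleton_subset_iff]
      exact ⟨Set.mem_of_eq_of_mem hi.symm (pow_mem (mem_adjoin_simple_self ℚ _) i),
        Set.mem_of_eq_of_mem hj.symm (pow_mem (mem_adjoin_simple_self ℚ _) j)⟩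
    · rw [adjoin_simple_le_iff]
      exact mul_mem (pow_mem (subset_adjoin _ _ (by simp)) _)
        (pow_mem (subset_adjoin _ _ (by simp)) _)
  rw [hadjoin, adjoin.finrank (hc.isIntegral hpos).tower_top,
    ← cyclotomic_eq_minpoly_rat hc hpos, natDegree_cyclotomic]

theorem Nat.totient_lcm_four_of_not_dvd {n : ℕ} (h : ¬ 4 ∣ n) :
    (Nat.lcm 4 n).totient = 2 * n.totient := by
  rcases Nat.even_or_odd n with he | ho
  · have hlcm : Nat.lcm 4 n = 2 * n := by
      obtain ⟨m, rfl⟩ := he.two_dvd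
      have hm : Nat.Coprime 2 m := by
        rw [Nat.coprime_two_left]
        by_contra h'
        rw [Nat.not_odd_iff_even] at h'
        obtain ⟨l, rfl⟩ := h'.two_dvd
        exact h ⟨l, by ring⟩
      rw [show 4 = 2 * 2 from rfl, Nat.lcm_mul_left, hm.lcm_eq_mul]
    rw [hlcm, Nat.totient_two_mul_of_even he]
  · have hco : Nat.Coprime 4 n := (Nat.coprime_two_left.mpr ho).pow_left 2
    rw [hco.lcm_eq_mul, Nat.totient_mul hco]
    rfl

/-- The field `ℚ(tan θ, i)` is generated by `i` and `exp(2iθ)`. -/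
theorem adjoin_tan_I_eq {θ : ℝ} (hθ : Real.cos θ ≠ 0) :
    adjoin ℚ {((Real.tan θ : ℝ) : ℂ), Complex.I} =
      adjoin ℚ {Complex.I, Complex.exp (2 * θ * Complex.I)} := by
  set t : ℂ := ((Real.tan θ : ℝ) : ℂ) with ht
  set z := Complex.exp (2 * θ * Complex.I) with hz
  have hc : Complex.cos θ ≠ 0 := by exact_mod_cast hθ
  have htc : t * Complex.cos θ = Complex.sin θ := by
    rw [ht, Complex.ofReal_tan, Complex.tan_mul_cos hc]
  have hzc : z = (Complex.cos θ + Complex.sin θ * Complex.I) ^ 2 := by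
    rw [hz, ← Complex.exp_mul_I, ← Complex.exp_nat_mul]
    push_cast
    ring_nf
  have hcs := Complex.sin_sq_add_cos_sq (θ : ℂ)
  have hI := Complex.I_sq
  have hsub : 1 - t * Complex.I ≠ 0 := by
    intro h
    simpa [ht, -Complex.ofReal_tan] using congrArg Complex.re h
  have hrel : z * (1 - t * Complex.I) = 1 + t * Complex.I := by
    apply mul_right_cancel₀ hc
    rw [hzc]
    linear_combination
      (-(Complex.cos θ + Complex.sin θ * Complex.I) ^ 2 * Complex.I - Complex.I) * htc +
      (Complex.cos θ + Complex.sin θ * Complex.I) * hcs -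
      (Complex.cos θ + Complex.sin θ * Complex.I) * Complex.sin θ ^ 2 * hI
  have hadd : z + 1 ≠ 0 := by
    intro h
    have : (2 : ℂ) = 0 := by linear_combination (1 - t * Complex.I) * h - hrel
    norm_num at this
  have hzt : z = (1 + t * Complex.I) / (1 - t * Complex.I) := by
    rw [eq_div_iff hsub, hrel]
  have htz : t = (z - 1) / (Complex.I * (z + 1)) := by
    rw [eq_div_iff (mul_ne_zero Complex.I_ne_zero hadd)]
    linear_combination -hrel
  apply le_antisymm <;> rw [adjoin_le_iff, Set.insert_subset_iff, Set.singleton_subset_iff]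
  · have h1 : Complex.I ∈ adjoin ℚ {Complex.I, z} := subset_adjoin _ _ (by simp)
    have h2 : z ∈ adjoin ℚ {Complex.I, z} := subset_adjoin _ _ (by simp)
    refine ⟨?_, h1⟩
    rw [SetLike.mem_coe, htz]
    exact div_mem (sub_mem h2 (one_mem _)) (mul_mem h1 (add_mem h2 (one_mem _)))
  · have h1 : Complex.I ∈ adjoin ℚ {t, Complex.I} := subset_adjoin _ _ (by simp)
    have h2 : t ∈ adjoin ℚ {t, Complex.I} := subset_adjoin _ _ (by simp)
    refine ⟨h1, ?_⟩
    rw [SetLike.mem_coe, hzt]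
    exact div_mem (add_mem (one_mem _) (mul_mem h2 h1)) (sub_mem (one_mem _) (mul_mem h2 h1))

/-- Complexity Theorem, Part 2: for an integer `n > 2` and an integer `k`
with `gcd(k, n) = 1`, the degree of `tan(kπ/n)` over `ℚ` is `φ(n)` when
`4 ∤ n`, and `φ(n)/2` when `4 ∣ n`. -/
theorem tan_degree (n : ℕ) (hn : 2 < n) (k : ℤ) (hk : Int.gcd k n = 1) :
    (¬ (4 ∣ n) →
      (minpoly ℚ (Real.tan (k * Real.pi / n))).natDegree = n.totient) ∧
    (4 ∣ n →
      (minpoly ℚ (Real.tan (k * Real.pi / n))).natDegree = n.totient / 2) := by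
  have hn0 : n ≠ 0 := by omega
  set θ : ℝ := k * Real.pi / n with hθ
  have hprim : IsPrimitiveRoot (Complex.exp (2 * θ * Complex.I)) n := by
    convert! (Complex.isPrimitiveRoot_exp n hn0).zpow_of_gcd_eq_one k hk using 1
    rw [← Complex.exp_int_mul, hθ]
    push_cast
    ring_nf
  have hcos : Real.cos θ ≠ 0 := by
    intro h
    have hc : Complex.cos θ = 0 := by exact_mod_cast h
    have hone : Complex.exp (2 * θ * Complex.I) ^ 2 = 1 := by
      rw [Complex.exp_mul_I, Complex.cos_two_mul, Complex.sin_two_mul, hc]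
      ring
    exact absurd (Nat.le_of_dvd two_pos (hprim.dvd_of_pow_eq_one 2 hone)) (by omega)
  have hfield := finrank_adjoin_ofReal_I_s14 (Real.tan θ)
  rw [adjoin_tan_I_eq hcos,
    Complex.isPrimitiveRoot_I.finrank_adjoin_pair hprim (by norm_num) hn0] at hfield
  have hpos : 0 < (Nat.lcm 4 n).totient :=
    Nat.totient_pos.mpr (Nat.lcm_pos (by norm_num) (by omega))
  have hint : IsIntegral ℚ ((Real.tan θ : ℝ) : ℂ) := by
    have : FiniteDimensional ℚ ℚ⟮((Real.tan θ : ℝ) : ℂ)⟯ :=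
      Module.finite_of_finrank_pos (by omega)
    exact (AdjoinSimple.isIntegral_gen ℚ _).mp (IsIntegral.of_finite ℚ _)
  have hmin : minpoly ℚ ((Real.tan θ : ℝ) : ℂ) = minpoly ℚ (Real.tan θ) :=
    minpoly.algebraMap_eq Complex.ofReal_injective _
  rw [adjoin.finrank hint, hmin] at hfield
  refine ⟨fun h => ?_, fun h => ?_⟩
  · rw [Nat.totient_lcm_four_of_not_dvd h] at hfield
    omega
  · rw [Nat.lcm_eq_right h] at hfield
    omega
end

section
/- Let N ≥ 3 be an integer not divisible by 4. A real number x is a root of the minimal polynomial of tan(π/N) over ℚ if and only if x = tan(kπ/N) for some integer k with 1 ≤ k < N and gcd(k, N) = 1. In particular, the minimal polynomial of tan(π/N) is an even polynomial whose positive roots are exactly the φ(N)/2 primitive star points tan(kπ/N) with 1 ≤ k < N/2 and gcd(k, N) = 1. -/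
open Polynomial

/-- The tangent as a rational function of `exp (2 θ I)`; both sides vanish when `cos θ = 0`. -/
theorem ofReal_tan_eq_exp_div (θ : ℝ) :
    (Real.tan θ : ℂ) =
      (Complex.exp (2 * θ * Complex.I) - 1) / (Complex.exp (2 * θ * Complex.I) + 1) / Complex.I := by
  have hexp : Complex.exp (2 * θ * Complex.I) =
      Complex.exp (θ * Complex.I) * Complex.exp (θ * Complex.I) := by
    rw [← Complex.exp_add]; ring_nf
  have hinv : Complex.exp (θ * Complex.I) * Complex.exp (-θ * Complex.I) = 1 := by
    rw [← Complex.exp_add]; simp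
  have hne := Complex.exp_ne_zero (θ * Complex.I)
  have hsub : Complex.exp (2 * θ * Complex.I) - 1 =
      2 * Complex.I * Complex.exp (θ * Complex.I) * Complex.sin θ := by
    rw [hexp, Complex.sin]
    linear_combination hinv -
      Complex.exp (θ * Complex.I) * (Complex.exp (-θ * Complex.I) - Complex.exp (θ * Complex.I)) *
        Complex.I_sq
  have hadd : Complex.exp (2 * θ * Complex.I) + 1 =
      2 * Complex.exp (θ * Complex.I) * Complex.cos θ := by
    rw [hexp, Complex.cos]
    linear_combination -hinv
  rw [hsub, hadd, Complex.ofReal_tan, Complex.tan]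
  by_cases hcos : Complex.cos θ = 0
  · simp [hcos]
  · field_simp

/-- The tangent of `k π / N` in terms of the standard primitive `N`-th root of unity. -/
theorem ofReal_tan_nat_mul_pi_div (N k : ℕ) :
    (Real.tan (k * Real.pi / N) : ℂ) =
      (Complex.exp (2 * Real.pi * Complex.I / N) ^ k - 1) /
        (Complex.exp (2 * Real.pi * Complex.I / N) ^ k + 1) / Complex.I := by
  rw [ofReal_tan_eq_exp_div, ← Complex.exp_nat_mul]
  push_cast
  ring_nf

theorem tan_natCast_sub_mul_pi_div {N k : ℕ} (hN : N ≠ 0) (hk : k ≤ N) :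
    Real.tan ((N - k : ℕ) * Real.pi / N) = -Real.tan (k * Real.pi / N) := by
  rw [← Real.tan_pi_sub, Nat.cast_sub hk]
  congr 1
  field_simp

/-- If `4 ∤ N`, every residue coprime to `N` lifts to one which is `1` modulo `4`. -/
theorem exists_modEq_and_modEq_one_four {N k : ℕ} (h4 : ¬ 4 ∣ N) (hk : k.Coprime N) :
    ∃ a : ℕ, a ≡ k [MOD N] ∧ a ≡ 1 [MOD 4] := by
  have hgcd : k ≡ 1 [MOD N.gcd 4] := by
    have h := Nat.gcd_dvd_right N 4
    have hle := Nat.le_of_dvd (by norm_num) h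
    have hN := Nat.gcd_dvd_left N 4
    have hk' : k.Coprime (N.gcd 4) := hk.coprime_dvd_right hN
    generalize N.gcd 4 = g at *
    interval_cases g
    · omega
    · exact Nat.modEq_one
    · exact Nat.odd_iff.mp (Nat.coprime_two_right.mp hk')
    · omega
    · exact absurd hN h4
  exact ⟨_, (Nat.chineseRemainder' hgcd).2⟩

theorem exp_two_pi_mul_I_div_four_mul_pow_four {N : ℕ} (hN : N ≠ 0) :
    Complex.exp (2 * Real.pi * Complex.I / (4 * N : ℕ)) ^ 4 =
      Complex.exp (2 * Real.pi * Complex.I / N) := by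
  have hNC : (N : ℂ) ≠ 0 := by exact_mod_cast hN
  rw [← Complex.exp_nat_mul]
  congr 1
  push_cast
  field_simp

theorem exp_two_pi_mul_I_div_four_mul_pow {N : ℕ} (hN : N ≠ 0) :
    Complex.exp (2 * Real.pi * Complex.I / (4 * N : ℕ)) ^ N = Complex.I := by
  have hNC : (N : ℂ) ≠ 0 := by exact_mod_cast hN
  rw [← Complex.exp_nat_mul]
  refine Eq.trans (congrArg Complex.exp ?_) Complex.exp_pi_div_two_mul_I
  push_cast
  field_simp
  norm_num

/-- Over a number `w` mapping to the standard primitive `4 N`-th root of unity, the roots in `ℂ` of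
the minimal polynomial of `tan (π / N)` are the images of `(w ^ 4 - 1) / (w ^ 4 + 1) / w ^ N`. -/
theorem aeval_minpoly_tan_pi_div_eq_zero_iff_exists_algHom {K : Type*} [Field K] [CharZero K]
    [Algebra.IsAlgebraic ℚ K] [Algebra K ℂ] {N : ℕ} (hN : N ≠ 0) {w : K}
    (hw : algebraMap K ℂ w = Complex.exp (2 * Real.pi * Complex.I / (4 * N : ℕ))) (x : ℝ) :
    aeval x (minpoly ℚ (Real.tan (Real.pi / N))) = 0 ↔
      ∃ σ : K →ₐ[ℚ] ℂ, (σ w ^ 4 - 1) / (σ w ^ 4 + 1) / σ w ^ N = x := by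
  have ht : algebraMap ℝ ℂ (Real.tan (Real.pi / N)) =
      algebraMap K ℂ ((w ^ 4 - 1) / (w ^ 4 + 1) / w ^ N) := by
    have h := ofReal_tan_nat_mul_pi_div N 1
    rw [Nat.cast_one, one_mul, pow_one] at h
    simp only [map_div₀, map_sub, map_add, map_pow, map_one, hw,
      exp_two_pi_mul_I_div_four_mul_pow_four hN, exp_two_pi_mul_I_div_four_mul_pow hN]
    exact h
  have hmin : minpoly ℚ (Real.tan (Real.pi / N)) =
      minpoly ℚ ((w ^ 4 - 1) / (w ^ 4 + 1) / w ^ N) := by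
    rw [← minpoly.algebraMap_eq (algebraMap ℝ ℂ).injective, ht,
      minpoly.algebraMap_eq (algebraMap K ℂ).injective]
  have hrange := Set.ext_iff.mp (Algebra.IsAlgebraic.range_eval_eq_rootSet_minpoly (F := ℚ) ℂ
    ((w ^ 4 - 1) / (w ^ 4 + 1) / w ^ N)) (x : ℂ)
  rw [mem_rootSet_of_ne (minpoly.ne_zero (Algebra.IsIntegral.isIntegral _))] at hrange
  rw [hmin, ← aeval_algebraMap_eq_zero_iff ℂ, Complex.coe_algebraMap, ← hrange]
  simp

/-- A field of algebraic numbers containing a primitive `n`-th root of unity `w` has an embedding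
sending `w` to any prescribed primitive `n`-th root of unity. -/
theorem exists_algHom_apply_eq_of_isPrimitiveRoot {K : Type*} [Field K] [CharZero K]
    [Algebra.IsAlgebraic ℚ K] {n : ℕ} (hn : 0 < n) {w : K} (hw : IsPrimitiveRoot w n) {u : ℂ}
    (hu : IsPrimitiveRoot u n) : ∃ σ : K →ₐ[ℚ] ℂ, σ w = u := by
  have hrange := Set.ext_iff.mp
    (Algebra.IsAlgebraic.range_eval_eq_rootSet_minpoly (F := ℚ) ℂ w) u
  refine hrange.mpr ?_
  rw [mem_rootSet_of_ne (minpoly.ne_zero (Algebra.IsIntegral.isIntegral w)),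
    ← cyclotomic_eq_minpoly_rat hw hn, aeval_def, eval₂_eq_eval_map, map_cyclotomic]
  exact hu.isRoot_cyclotomic hn

theorem aeval_minpoly_tan_pi_div_eq_zero_iff {N : ℕ} (hN : 2 ≤ N) (h4 : ¬ 4 ∣ N) (x : ℝ) :
    aeval x (minpoly ℚ (Real.tan (Real.pi / N))) = 0 ↔
      ∃ k : ℕ, 1 ≤ k ∧ k < N ∧ Nat.gcd k N = 1 ∧ x = Real.tan (k * Real.pi / N) := by
  have hN0 : N ≠ 0 := by omega
  have : NeZero N := ⟨hN0⟩
  have hζ := Complex.isPrimitiveRoot_exp N hN0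
  have hω := Complex.isPrimitiveRoot_exp (4 * N) (by positivity)
  have : Algebra.IsAlgebraic ℚ (algebraicClosure ℚ ℂ) := algebraicClosure.isAlgebraic ℚ ℂ
  obtain ⟨w, hw⟩ : ∃ w : algebraicClosure ℚ ℂ, algebraMap (algebraicClosure ℚ ℂ) ℂ w =
      Complex.exp (2 * Real.pi * Complex.I / (4 * N : ℕ)) :=
    ⟨⟨_, mem_algebraicClosure_iff.mpr
      (hω.isIntegral (by positivity)).tower_top.isAlgebraic⟩, rfl⟩
  have hwprim : IsPrimitiveRoot w (4 * N) :=
    IsPrimitiveRoot.of_map_of_injective (hw.symm ▸ hω)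
      (algebraMap (algebraicClosure ℚ ℂ) ℂ).injective
  rw [aeval_minpoly_tan_pi_div_eq_zero_iff_exists_algHom hN0 hw]
  constructor
  · rintro ⟨σ, hσ⟩
    have hσw : IsPrimitiveRoot (σ w) (4 * N) := hwprim.map_of_injective (RingHom.injective _)
    obtain ⟨k, hkN, hk, hσz⟩ := hζ.isPrimitiveRoot_iff.mp (hσw.pow (by positivity) rfl)
    have hk1 : 1 ≤ k := by
      rcases Nat.eq_zero_or_pos k with rfl | h
      · rw [Nat.coprime_zero_left] at hk; omega
      · exact h
    have hσi : σ w ^ N = Complex.I ∨ σ w ^ N = -Complex.I := by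
      apply sq_eq_sq_iff_eq_or_eq_neg.mp
      rw [Complex.I_sq, ← pow_mul]
      exact (hσw.pow (by positivity) (show 4 * N = N * 2 * 2 by ring)).eq_neg_one_of_two_right
    have htan := ofReal_tan_nat_mul_pi_div N k
    rw [hσz] at htan
    rcases hσi with h | h
    · rw [h, ← htan] at hσ
      exact ⟨k, hk1, hkN, hk, by exact_mod_cast hσ.symm⟩
    · rw [h, div_neg, ← htan] at hσ
      refine ⟨N - k, by omega, by omega, (Nat.coprime_self_sub_left hkN.le).mpr hk, ?_⟩
      rw [tan_natCast_sub_mul_pi_div hN0 hkN.le]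
      exact_mod_cast hσ.symm
  · rintro ⟨k, -, -, hk, rfl⟩
    obtain ⟨a, haN, ha4⟩ := exists_modEq_and_modEq_one_four h4 hk
    have hcop : a.Coprime (4 * N) := by
      refine Nat.Coprime.mul_right ?_ ?_
      · rw [Nat.Coprime, ha4.gcd_eq]; norm_num
      · rw [Nat.Coprime, haN.gcd_eq]; exact hk
    obtain ⟨σ, hσ⟩ := exists_algHom_apply_eq_of_isPrimitiveRoot (by positivity) hwprim
      (hω.pow_of_coprime a hcop)
    have hI : Complex.I ^ a = Complex.I ^ 1 :=
      pow_eq_pow_of_modEq ha4 Complex.I_pow_four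
    have hz := pow_eq_pow_of_modEq haN hζ.pow_eq_one
    refine ⟨σ, ?_⟩
    rw [hσ, pow_right_comm, pow_right_comm _ a N, exp_two_pi_mul_I_div_four_mul_pow_four hN0,
      exp_two_pi_mul_I_div_four_mul_pow hN0, hI, pow_one, hz, ofReal_tan_nat_mul_pi_div]

/-- If `-x` is a conjugate of `x ≠ 0`, then the minimal polynomial of `x` is even. -/
theorem minpoly_comp_neg_X_of_aeval_neg_eq_zero {K L : Type*} [Field K] [Field L] [Algebra K L]
    {x : L} (hint : IsIntegral K x) (hx : x ≠ 0) (h : aeval (-x) (minpoly K x) = 0) :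
    (minpoly K x).comp (-X) = minpoly K x := by
  have hneg := minpoly.neg (A := K) x
  rw [← minpoly.eq_of_irreducible_of_monic (minpoly.irreducible hint) h
    (minpoly.monic hint)] at hneg
  have h0 : (minpoly K x).eval 0 ≠ 0 := by
    rw [← coeff_zero_eq_eval_zero]; exact minpoly.coeff_zero_ne_zero hint hx
  have heval : (minpoly K x).eval 0 =
      (-1) ^ (minpoly K x).natDegree * (minpoly K x).eval 0 := by
    conv_lhs => rw [hneg]
    simp [eval_comp]
  have hsign : (-1 : K) ^ (minpoly K x).natDegree = 1 :=
    mul_right_cancel₀ h0 (by rw [← heval, one_mul])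
  have hsign' : (-1 : K[X]) ^ (minpoly K x).natDegree = 1 := by
    simpa using congrArg C hsign
  rw [hsign', one_mul] at hneg
  exact hneg.symm

/-- Root characterization when `4 ∤ N`: a real `x` is a root of the minimal
polynomial of `tan(π/N)` over `ℚ` iff `x = tan(kπ/N)` for some `1 ≤ k < N`
with `gcd(k, N) = 1`; in particular this minimal polynomial is an even
polynomial (whose positive roots are exactly the primitive star points). -/
theorem minpoly_tan_roots_of_not_four_dvd
    (N : ℕ) (hN : 3 ≤ N) (h4 : ¬ (4 ∣ N)) :
    (∀ x : ℝ,
      Polynomial.aeval x (minpoly ℚ (Real.tan (Real.pi / N))) = 0 ↔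
        ∃ k : ℕ, 1 ≤ k ∧ k < N ∧ Nat.gcd k N = 1 ∧ x = Real.tan (k * Real.pi / N)) ∧
    (∀ x : ℝ,
      Polynomial.aeval (-x) (minpoly ℚ (Real.tan (Real.pi / N))) =
        Polynomial.aeval x (minpoly ℚ (Real.tan (Real.pi / N)))) := by
  have hroots := aeval_minpoly_tan_pi_div_eq_zero_iff (by omega : 2 ≤ N) h4
  refine ⟨hroots, fun x => ?_⟩
  have hN0 : N ≠ 0 := by omega
  have hneg : aeval (-Real.tan (Real.pi / N)) (minpoly ℚ (Real.tan (Real.pi / N))) = 0 := by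
    refine (hroots _).mpr ⟨N - 1, by omega, by omega,
      (Nat.coprime_self_sub_left (by omega)).mpr (Nat.coprime_one_left N), ?_⟩
    rw [tan_natCast_sub_mul_pi_div hN0 (by omega), Nat.cast_one, one_mul]
  have htan : 0 < Real.tan (Real.pi / N) := by
    apply Real.tan_pos_of_pos_of_lt_pi_div_two (by positivity)
    have : (3 : ℝ) ≤ N := by exact_mod_cast hN
    exact div_lt_div_of_pos_left Real.pi_pos two_pos (by linarith)
  have hint : IsIntegral ℚ (Real.tan (Real.pi / N)) := by
    have h := (Real.isAlgebraic_tan_rat_mul_pi (1 / N)).extendScalars (Int.cast_injective (α := ℚ))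
    have hq : ((1 / N : ℚ) : ℝ) * Real.pi = Real.pi / N := by push_cast; ring
    rw [hq] at h
    exact h.isIntegral
  conv_rhs => rw [← minpoly_comp_neg_X_of_aeval_neg_eq_zero hint htan.ne' hneg]
  simp [aeval_comp]
end

section
/- Let N ≥ 4 be an integer divisible by 4. A real number x is a root of the minimal polynomial of tan(π/N) over ℚ if and only if x = tan(jπ/N) for some integer j with 1 ≤ j < N, gcd(j, N) = 1 and j ≡ 1 (mod 4). In particular this minimal polynomial has exactly φ(N)/2 roots, all real. -/
/-- The expression `-z ^ (N / 4) * (z - 1) / (z + 1)`, which for `z = exp (2πi / N)` and `4 ∣ N`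
equals `tan (π / N)`. -/
def tanOfRootOfUnity {K : Type*} [Field K] (N : ℕ) (z : K) : K :=
  -z ^ (N / 4) * ((z - 1) / (z + 1))

theorem map_tanOfRootOfUnity {K L : Type*} [Field K] [Field L] [Algebra ℚ K] [Algebra ℚ L]
    (f : K →ₐ[ℚ] L) (N : ℕ) (z : K) :
    f (tanOfRootOfUnity N z) = tanOfRootOfUnity N (f z) := by
  simp [tanOfRootOfUnity]

theorem Complex.exp_two_mul_I_sub_one_div_add_one (θ : ℂ) (h : Complex.cos θ ≠ 0) :
    (Complex.exp (2 * θ * Complex.I) - 1) / (Complex.exp (2 * θ * Complex.I) + 1) =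
      Complex.I * Complex.tan θ := by
  have hexp : Complex.exp (2 * θ * Complex.I) =
      (Complex.cos θ + Complex.sin θ * Complex.I) ^ 2 := by
    rw [← Complex.exp_mul_I, ← Complex.exp_nat_mul]
    congr 1
    push_cast
    ring
  have hsq := Complex.sin_sq_add_cos_sq θ
  have hne : Complex.cos θ + Complex.sin θ * Complex.I ≠ 0 := by
    rw [← Complex.exp_mul_I]
    exact Complex.exp_ne_zero _
  have hadd : Complex.exp (2 * θ * Complex.I) + 1 =
      2 * Complex.cos θ * (Complex.cos θ + Complex.sin θ * Complex.I) := by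
    rw [hexp]
    linear_combination -hsq + (Complex.sin θ) ^ 2 * Complex.I_sq
  have hsub : Complex.exp (2 * θ * Complex.I) - 1 =
      2 * Complex.I * Complex.sin θ * (Complex.cos θ + Complex.sin θ * Complex.I) := by
    rw [hexp]
    linear_combination hsq - (Complex.sin θ) ^ 2 * Complex.I_sq
  rw [hadd, hsub, mul_div_mul_right _ _ hne, Complex.tan_eq_sin_div_cos]
  field_simp

theorem Real.cos_mul_pi_div_ne_zero {N j : ℕ} (h4 : 4 ∣ N) (hN : N ≠ 0) (hj : j.Coprime N) :
    Real.cos (j * Real.pi / N) ≠ 0 := by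
  rw [Real.cos_ne_zero_iff]
  intro k hk
  have hN' : (N : ℝ) ≠ 0 := by exact_mod_cast hN
  have h : (2 * j : ℝ) = (2 * k + 1) * N := by
    field_simp at hk
    linarith
  have h' : (2 * j : ℤ) = (2 * k + 1) * N := by exact_mod_cast h
  obtain ⟨m, rfl⟩ := h4
  have hodd : j % 2 = 1 := by
    have : j.Coprime 2 := hj.coprime_dvd_right ⟨2 * m, by ring⟩
    exact Nat.odd_iff.mp (Nat.coprime_two_right.mp this)
  have : (j : ℤ) = 2 * ((2 * k + 1) * m) := by push_cast at h'; linarith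
  omega

theorem tanOfRootOfUnity_exp {N j : ℕ} (h4 : 4 ∣ N) (hN : N ≠ 0) (hj : j.Coprime N) :
    tanOfRootOfUnity N (Complex.exp (2 * Real.pi * Complex.I * (j / N))) =
      -Complex.I ^ (j + 1) * (Real.tan (j * Real.pi / N) : ℂ) := by
  have hN' : (N : ℂ) ≠ 0 := by exact_mod_cast hN
  have hcos : Complex.cos (j * Real.pi / N : ℝ) ≠ 0 := by
    rw [← Complex.ofReal_cos]
    exact_mod_cast Real.cos_mul_pi_div_ne_zero h4 hN hj
  have hpow : Complex.exp (2 * Real.pi * Complex.I * (j / N)) ^ (N / 4) = Complex.I ^ j := by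
    have hI : Complex.I ^ j = Complex.exp (j * (Real.pi / 2 * Complex.I)) := by
      rw [Complex.exp_nat_mul, Complex.exp_pi_div_two_mul_I]
    rw [← Complex.exp_nat_mul, Nat.cast_div h4 (by norm_num), hI]
    congr 1
    push_cast
    field_simp
    norm_num
  have harg : 2 * Real.pi * Complex.I * (j / N) =
      2 * ((j * Real.pi / N : ℝ) : ℂ) * Complex.I := by
    push_cast
    ring
  rw [tanOfRootOfUnity, hpow, harg, Complex.exp_two_mul_I_sub_one_div_add_one _ hcos,
    Complex.ofReal_tan]
  ring

theorem tanOfRootOfUnity_exp_of_mod_four_eq_one {N j : ℕ} (h4 : 4 ∣ N) (hN : N ≠ 0)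
    (hj : j.Coprime N) (hj4 : j % 4 = 1) :
    tanOfRootOfUnity N (Complex.exp (2 * Real.pi * Complex.I * (j / N))) =
      (Real.tan (j * Real.pi / N) : ℂ) := by
  rw [tanOfRootOfUnity_exp h4 hN hj, Complex.I_pow_eq_pow_mod, show (j + 1) % 4 = 2 by omega,
    Complex.I_sq, neg_neg, one_mul]

theorem tanOfRootOfUnity_exp_of_mod_four_eq_three {N j : ℕ} (h4 : 4 ∣ N) (hN : N ≠ 0)
    (hjN : j ≤ N) (hj : j.Coprime N) (hj4 : j % 4 = 3) :
    tanOfRootOfUnity N (Complex.exp (2 * Real.pi * Complex.I * (j / N))) =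
      (Real.tan ((N - j : ℕ) * Real.pi / N) : ℂ) := by
  have hN' : (N : ℝ) ≠ 0 := by exact_mod_cast hN
  have harg : ((N - j : ℕ) : ℝ) * Real.pi / N = Real.pi - j * Real.pi / N := by
    rw [Nat.cast_sub hjN]
    field_simp
  rw [tanOfRootOfUnity_exp h4 hN hj, Complex.I_pow_eq_pow_mod, show (j + 1) % 4 = 0 by omega,
    harg, Real.tan_pi_sub]
  simp

theorem Nat.Coprime.mod_four_eq_one_or_three {N j : ℕ} (h4 : 4 ∣ N) (hj : j.Coprime N) :
    j % 4 = 1 ∨ j % 4 = 3 := by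
  have h2 : j.Coprime 2 := hj.coprime_dvd_right (Dvd.dvd.trans (by norm_num) h4)
  have := Nat.odd_iff.mp (Nat.coprime_two_right.mp h2)
  omega

/-- The residues below `N` that are coprime to `N` and congruent to `1` modulo `4`. -/
def coprimeOneModFour (N : ℕ) : Finset ℕ :=
  {j ∈ Finset.range N | j.Coprime N ∧ j % 4 = 1}

theorem mem_coprimeOneModFour {N j : ℕ} :
    j ∈ coprimeOneModFour N ↔ j < N ∧ j.Coprime N ∧ j % 4 = 1 := by
  simp [coprimeOneModFour]

theorem card_coprimeOneModFour {N : ℕ} (h4 : 4 ∣ N) :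
    (coprimeOneModFour N).card = N.totient / 2 := by
  have hsub : ∀ j, j < N → j.Coprime N → (N - j).Coprime N := fun j hj h ↦
    (Nat.coprime_self_sub_left hj.le).mpr h
  have hthree : (coprimeOneModFour N).card =
      ({j ∈ Finset.range N | j.Coprime N ∧ j % 4 = 3} : Finset ℕ).card := by
    refine Finset.card_nbij' (fun j ↦ N - j) (fun j ↦ N - j) ?_ ?_ ?_ ?_
    · intro j hj
      obtain ⟨hjN, hjc, hj4⟩ := mem_coprimeOneModFour.mp hj
      simp only [Finset.coe_filter, Finset.mem_range, Set.mem_ofPred_eq]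
      exact ⟨by omega, hsub j hjN hjc, by omega⟩
    · intro j hj
      simp only [Finset.coe_filter, Finset.mem_range, Set.mem_ofPred_eq] at hj
      exact mem_coprimeOneModFour.mpr ⟨by lia, hsub j hj.1 hj.2.1, by lia⟩
    · intro j hj
      have := (mem_coprimeOneModFour.mp hj).1
      simp only
      omega
    · intro j hj
      simp only [Finset.coe_filter, Finset.mem_range, Set.mem_ofPred_eq] at hj
      simp only
      omega
  have htot : N.totient = (coprimeOneModFour N).card +
      ({j ∈ Finset.range N | j.Coprime N ∧ j % 4 = 3} : Finset ℕ).card := by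
    rw [Nat.totient_eq_card_coprime, coprimeOneModFour, ← Finset.card_union_of_disjoint]
    · congr 1
      ext j
      simp only [Finset.mem_filter, Finset.mem_union, Nat.coprime_comm (n := N)]
      have := fun h : j.Coprime N ↦ h.mod_four_eq_one_or_three h4
      tauto
    · rw [Finset.disjoint_filter]
      omega
  omega

/-- The complex conjugates of `tan (π / N)` are the numbers `tan (jπ / N)`; they are the images of
`tanOfRootOfUnity N ζ` under the embeddings of the `N`-th cyclotomic field. -/
theorem rootSet_minpoly_tan_pi_div {N : ℕ} (hN : 4 ≤ N) (h4 : 4 ∣ N) :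
    (minpoly ℚ (Real.tan (Real.pi / N))).rootSet ℂ =
      (fun j : ℕ ↦ (Real.tan (j * Real.pi / N) : ℂ)) '' coprimeOneModFour N := by
  have hN0 : N ≠ 0 := by omega
  have : NeZero N := ⟨hN0⟩
  obtain ⟨K, _, _, _⟩ : ∃ (K : Type) (_ : Field K) (_ : Algebra ℚ K),
      IsCyclotomicExtension {N} ℚ K :=
    ⟨CyclotomicField N ℚ, inferInstance, CyclotomicField.algebra N ℚ, inferInstance⟩
  have : FiniteDimensional ℚ K := IsCyclotomicExtension.finiteDimensional {N} ℚ K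
  have hζ : IsPrimitiveRoot (IsCyclotomicExtension.zeta N ℚ K) N :=
    IsCyclotomicExtension.zeta_spec N ℚ K
  set ζ := IsCyclotomicExtension.zeta N ℚ K
  have hexists : ∀ j : ℕ, j < N → j.Coprime N →
      ∃ ψ : K →ₐ[ℚ] ℂ, ψ ζ = Complex.exp (2 * Real.pi * Complex.I * (j / N)) := by
    intro j hjN hj
    have hprim := (Complex.isPrimitiveRoot_iff _ N hN0).mpr ⟨j, hjN, hj, rfl⟩
    let e := hζ.embeddingsEquivPrimitiveRoots ℂ (Polynomial.cyclotomic.irreducible_rat hN0.bot_lt)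
    refine ⟨e.symm ⟨_, (mem_primitiveRoots hN0.bot_lt).mpr hprim⟩, ?_⟩
    rw [← hζ.embeddingsEquivPrimitiveRoots_apply_coe ℂ
      (Polynomial.cyclotomic.irreducible_rat hN0.bot_lt), Equiv.apply_symm_apply]
  have hminpoly : minpoly ℚ (Real.tan (Real.pi / N)) = minpoly ℚ (tanOfRootOfUnity N ζ) := by
    obtain ⟨ψ, hψ⟩ := hexists 1 (by omega) (Nat.coprime_one_left N)
    rw [← minpoly.algHom_eq ψ ψ.injective, map_tanOfRootOfUnity, hψ,
      tanOfRootOfUnity_exp_of_mod_four_eq_one h4 hN0 (Nat.coprime_one_left N) rfl,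
      ← Complex.coe_algebraMap, minpoly.algebraMap_eq (algebraMap ℝ ℂ).injective]
    simp
  rw [hminpoly, ← Algebra.IsAlgebraic.range_eval_eq_rootSet_minpoly]
  ext x
  simp only [Set.mem_range, Set.mem_image, Finset.mem_coe, mem_coprimeOneModFour,
    map_tanOfRootOfUnity]
  constructor
  · rintro ⟨ψ, rfl⟩
    obtain ⟨j, hjN, hj, hψ⟩ :=
      (Complex.isPrimitiveRoot_iff (ψ ζ) N hN0).mp (hζ.map_of_injective ψ.injective)
    rw [← hψ]
    rcases hj.mod_four_eq_one_or_three h4 with hj4 | hj4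
    · exact ⟨j, ⟨hjN, hj, hj4⟩, (tanOfRootOfUnity_exp_of_mod_four_eq_one h4 hN0 hj hj4).symm⟩
    · exact ⟨N - j, ⟨by omega, (Nat.coprime_self_sub_left hjN.le).mpr hj, by omega⟩,
        (tanOfRootOfUnity_exp_of_mod_four_eq_three h4 hN0 hjN.le hj hj4).symm⟩
  · rintro ⟨j, ⟨hjN, hj, hj4⟩, rfl⟩
    obtain ⟨ψ, hψ⟩ := hexists j hjN hj
    exact ⟨ψ, by rw [hψ, tanOfRootOfUnity_exp_of_mod_four_eq_one h4 hN0 hj hj4]⟩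

theorem injOn_tan_mul_pi_div {N : ℕ} (h4 : 4 ∣ N) (hN : N ≠ 0) :
    Set.InjOn (fun j : ℕ ↦ Real.tan (j * Real.pi / N)) (coprimeOneModFour N) := by
  intro a ha b hb hab
  obtain ⟨haN, hac, -⟩ := mem_coprimeOneModFour.mp ha
  obtain ⟨hbN, hbc, -⟩ := mem_coprimeOneModFour.mp hb
  have hN' : (0 : ℝ) < N := by exact_mod_cast hN.bot_lt
  simp only [Real.tan_eq_sin_div_cos] at hab
  rw [div_eq_div_iff (Real.cos_mul_pi_div_ne_zero h4 hN hac)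
    (Real.cos_mul_pi_div_ne_zero h4 hN hbc)] at hab
  have hsin : Real.sin (a * Real.pi / N - b * Real.pi / N) = 0 := by
    rw [Real.sin_sub]
    linarith
  obtain ⟨k, hk⟩ := Real.sin_eq_zero_iff.mp hsin
  have hk' : (k * N : ℝ) = a - b := by
    have := Real.pi_ne_zero
    field_simp at hk
    linarith
  have hk'' : k * N = (a : ℤ) - b := by exact_mod_cast hk'
  have hdvd : (N : ℤ) ∣ (a : ℤ) - b := ⟨k, by rw [← hk'']; ring⟩
  have := Int.eq_zero_of_abs_lt_dvd hdvd (by rw [abs_lt]; omega)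
  omega


/-- Root Lemma when `4 ∣ N`: a real `x` is a root of the minimal polynomial of
`tan(π/N)` over `ℚ` iff `x = tan(jπ/N)` for some `1 ≤ j < N` with
`gcd(j, N) = 1` and `j ≡ 1 (mod 4)`; in particular the minimal polynomial has
degree `φ(N)/2` and exactly `φ(N)/2` roots, all of them real. -/
theorem minpoly_tan_roots_of_four_dvd
    (N : ℕ) (hN : 4 ≤ N) (h4 : 4 ∣ N) :
    (∀ x : ℝ,
      Polynomial.aeval x (minpoly ℚ (Real.tan (Real.pi / N))) = 0 ↔
        ∃ j : ℕ, 1 ≤ j ∧ j < N ∧ Nat.gcd j N = 1 ∧ j % 4 = 1 ∧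
          x = Real.tan (j * Real.pi / N)) ∧
    (minpoly ℚ (Real.tan (Real.pi / N))).natDegree = N.totient / 2 ∧
    {x : ℝ | Polynomial.aeval x (minpoly ℚ (Real.tan (Real.pi / N))) = 0}.ncard =
      N.totient / 2 := by
  have hN0 : N ≠ 0 := by omega
  have hint : IsIntegral ℚ (Real.tan (Real.pi / N)) := by
    by_contra h
    have hroots := rootSet_minpoly_tan_pi_div hN h4
    have hone : 1 ∈ coprimeOneModFour N :=
      mem_coprimeOneModFour.mpr ⟨by omega, Nat.coprime_one_left N, rfl⟩
    rw [minpoly.eq_zero h, Polynomial.rootSet_zero] at hroots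
    exact (hroots ▸ Set.mem_image_of_mem _ hone : _ ∈ (∅ : Set ℂ))
  have hroot : ∀ x : ℝ, Polynomial.aeval x (minpoly ℚ (Real.tan (Real.pi / N))) = 0 ↔
      ∃ j ∈ coprimeOneModFour N, Real.tan (j * Real.pi / N) = x := by
    intro x
    have hx : Polynomial.aeval x (minpoly ℚ (Real.tan (Real.pi / N))) = 0 ↔
        (x : ℂ) ∈ (minpoly ℚ (Real.tan (Real.pi / N))).rootSet ℂ := by
      rw [Polynomial.mem_rootSet_of_ne (minpoly.ne_zero hint), ← Complex.coe_algebraMap,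
        Polynomial.aeval_algebraMap_apply, FaithfulSMul.algebraMap_eq_zero_iff]
    simp only [hx, rootSet_minpoly_tan_pi_div hN h4, Set.mem_image, Finset.mem_coe,
      Complex.ofReal_inj]
  refine ⟨fun x ↦ ?_, ?_, ?_⟩
  · rw [hroot]
    constructor
    · rintro ⟨j, hj, rfl⟩
      obtain ⟨hjN, hjc, hj4⟩ := mem_coprimeOneModFour.mp hj
      exact ⟨j, by omega, hjN, hjc, hj4, rfl⟩
    · rintro ⟨j, -, hjN, hjc, hj4, rfl⟩
      exact ⟨j, mem_coprimeOneModFour.mpr ⟨hjN, hjc, hj4⟩, rfl⟩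
  · rw [← Polynomial.card_rootSet_eq_natDegree (K := ℂ) (minpoly.irreducible hint).separable
      (IsAlgClosed.splits _), ← Nat.card_eq_fintype_card, Nat.card_coe_set_eq,
      rootSet_minpoly_tan_pi_div hN h4, Set.InjOn.ncard_image, Set.ncard_coe_finset,
      card_coprimeOneModFour h4]
    exact Complex.ofReal_injective.comp_injOn (injOn_tan_mul_pi_div h4 hN0)
  · have hset : {x : ℝ | Polynomial.aeval x (minpoly ℚ (Real.tan (Real.pi / N))) = 0} =
        (fun j : ℕ ↦ Real.tan (j * Real.pi / N)) '' coprimeOneModFour N := by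
      ext x
      simp [hroot]
    rw [hset, (injOn_tan_mul_pi_div h4 hN0).ncard_image, Set.ncard_coe_finset,
      card_coprimeOneModFour h4]
end
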